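/- Let Θ, r, z be real numbers with 0 < Θ ≤ π/2, 0 ≤ r ≤ π/4, and |z| ≤ Θ/4. Then cos²(r)·sin(Θ/2) + sin(z)·cos(z + Θ/2) = (1/2)(sin(Θ/2)·cos(2r) + sin(Θ/2 + 2z)) ≥ 0, with equality if and only if r = π/4 and z = −Θ/4. -/

import Mathlib

open Real

/-- For 0 < Θ ≤ π/2, 0 ≤ r ≤ π/4, |z| ≤ Θ/4:
cos²r·sin(Θ/2) + sin z·cos(z+Θ/2) = (1/2)(sin(Θ/2)cos(2r) + sin(Θ/2+2z)) ≥ 0,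
with equality iff r = π/4 and z = −Θ/4. -/
theorem killing_field_normal_inner_product_sign (Θ r z : ℝ)
    (hΘ0 : 0 < Θ) (hΘ : Θ ≤ π / 2) (hr0 : 0 ≤ r) (hr : r ≤ π / 4) (hz : |z| ≤ Θ / 4) :
    Real.cos r ^ 2 * Real.sin (Θ / 2) + Real.sin z * Real.cos (z + Θ / 2) =
      (1 / 2) * (Real.sin (Θ / 2) * Real.cos (2 * r) + Real.sin (Θ / 2 + 2 * z)) ∧
    0 ≤ Real.cos r ^ 2 * Real.sin (Θ / 2) + Real.sin z * Real.cos (z + Θ / 2) ∧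
    (Real.cos r ^ 2 * Real.sin (Θ / 2) + Real.sin z * Real.cos (z + Θ / 2) = 0 ↔
      r = π / 4 ∧ z = -(Θ / 4)) := by
  obtain ⟨hz1, hz2⟩ := abs_le.mp hz
  have hπ := Real.pi_pos
  have identity : Real.cos r ^ 2 * Real.sin (Θ / 2) + Real.sin z * Real.cos (z + Θ / 2) =
      (1 / 2) * (Real.sin (Θ / 2) * Real.cos (2 * r) + Real.sin (Θ / 2 + 2 * z)) := by
    rw [Real.cos_add, Real.sin_add, Real.cos_two_mul, Real.cos_two_mul, Real.sin_two_mul]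
    linear_combination (-Real.sin (Θ / 2)) * Real.sin_sq_add_cos_sq z
  have hsin : 0 < Real.sin (Θ / 2) := Real.sin_pos_of_pos_of_lt_pi (by linarith) (by linarith)
  have hcos : 0 ≤ Real.cos (2 * r) :=
    Real.cos_nonneg_of_neg_pi_div_two_le_of_le (by linarith) (by linarith)
  have hsin_add : 0 ≤ Real.sin (Θ / 2 + 2 * z) :=
    Real.sin_nonneg_of_nonneg_of_le_pi (by linarith) (by linarith)
  have hprod := mul_nonneg hsin.le hcos
  refine ⟨identity, by rw [identity]; positivity, ?_⟩
  rw [identity]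
  constructor
  · intro h
    constructor
    · by_contra hne
      have hlt : r < π / 4 := lt_of_le_of_ne hr hne
      have hcos_pos : 0 < Real.cos (2 * r) :=
        Real.cos_pos_of_mem_Ioo ⟨by linarith, by linarith⟩
      have := mul_pos hsin hcos_pos
      linarith
    · by_contra hne
      have hlt : -(Θ / 4) < z := lt_of_le_of_ne hz1 (Ne.symm hne)
      have : 0 < Real.sin (Θ / 2 + 2 * z) :=
        Real.sin_pos_of_pos_of_lt_pi (by linarith) (by linarith)
      linarith
  · rintro ⟨rfl, rfl⟩
    rw [show 2 * (π / 4) = π / 2 by ring, show Θ / 2 + 2 * -(Θ / 4) = 0 by ring]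
    simp
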